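/- Let n ≡ 2 (mod 4), let q ≡ 3 (mod 4) be a prime power, and let X ⊆ 𝔽_q^n. Suppose there is a constant C₁ > 0 such that for every r ∈ 𝔽_q \ {0} and every f : S_r → ℂ, the extension estimate ( Σ_{c ∈ 𝔽_q^n} | |S_r|^{-1} Σ_{x ∈ S_r} χ(c·x) f(x) |^{(2n+4)/n} )^{n/(2n+4)} ≤ C₁ ( |S_r|^{-1} Σ_{x ∈ S_r} |f(x)|² )^{1/2} holds. Then there is a constant C depending only on C₁ such that the number of isosceles triangles in X, that is #{(x, y, z) ∈ X³ : ||x − y|| = ||z − y||}, is at most C ( |X|³/q + q^{n−1} |X|^{(n+4)/(n+2)} + q^{(n−2)/2} |X|² ). -/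

import Mathlib

open Finset

/-- Dot product `x·y = x₁y₁ + ⋯ + xₙyₙ` on `𝔽_q^n`. -/
def dotP {F : Type*} [CommRing F] {n : ℕ} (x y : Fin n → F) : F := ∑ i, x i * y i

/-- The "norm" `‖x‖ = x₁² + ⋯ + xₙ²` on `𝔽_q^n`. -/
def nrm {F : Type*} [CommRing F] {n : ℕ} (x : Fin n → F) : F := ∑ i, x i * x i

/-- The sphere `S_r = {x ∈ 𝔽_q^n : ‖x‖ = r}`. -/
def sph (F : Type*) [CommRing F] [Fintype F] [DecidableEq F] (n : ℕ) (r : F) :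
    Finset (Fin n → F) := Finset.univ.filter fun x => nrm x = r

/-- The dot product set `∏(E) = {x·y : x, y ∈ E}`. -/
def prodSet {F : Type*} [CommRing F] [DecidableEq F] {n : ℕ} (E : Finset (Fin n → F)) :
    Finset F := (E ×ˢ E).image fun p => dotP p.1 p.2

/-- Fourier transform of the indicator function of `X`:
`X̂(m) = q^{-n} ∑_{x ∈ X} χ(-x·m)`. -/
noncomputable def fourierCoef {F : Type*} [CommRing F] [Fintype F] {n : ℕ}
    (χ : AddChar F ℂ) (X : Finset (Fin n → F)) (m : Fin n → F) : ℂ :=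
  ((Fintype.card F : ℂ) ^ n)⁻¹ * ∑ x ∈ X, χ (-(dotP x m))

section Vectors

variable {R : Type*} [CommRing R] {n : ℕ}

lemma dotP_sub_right (x y z : Fin n → R) : dotP x (y - z) = dotP x y - dotP x z := by
  simp [dotP, mul_sub]

lemma nrm_neg (x : Fin n → R) : nrm (-x) = nrm x := by
  simp [nrm]

lemma addChar_dotP_mul (χ : AddChar R ℂ) (y m x : Fin n → R) :
    χ (dotP y m) * χ (-dotP m x) = χ (dotP m (y - x)) := by
  rw [← AddChar.map_add_eq_mul, dotP_sub_right, sub_eq_add_neg]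
  congr 2
  simp [dotP, mul_comm]

end Vectors

lemma AddChar.map_finset_sum_eq_prod {A M ι : Type*} [AddCommMonoid A] [CommMonoid M]
    (ψ : AddChar A M) (s : Finset ι) (f : ι → A) : ψ (∑ i ∈ s, f i) = ∏ i ∈ s, ψ (f i) := by
  classical
  induction s using Finset.induction_on with
  | empty => simp
  | insert a s ha ih => rw [sum_insert ha, prod_insert ha, AddChar.map_add_eq_mul, ih]

/-- Plancherel's identity for a finite family of orthogonal functions of equal norm. -/
lemma sum_norm_sq_eq_of_orthogonal {α β : Type*} [Fintype α] [Fintype β] [DecidableEq α]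
    (e : β → α → ℂ) (K : ℝ)
    (he : ∀ a a', ∑ b, e b a * starRingEnd ℂ (e b a') = if a = a' then (K : ℂ) else 0)
    (g : α → ℂ) : ∑ b, ‖∑ a, g a * e b a‖ ^ 2 = K * ∑ a, ‖g a‖ ^ 2 := by
  have h : ∑ b, (∑ a, g a * e b a) * starRingEnd ℂ (∑ a, g a * e b a)
      = K * ∑ a, g a * starRingEnd ℂ (g a) := by
    calc _ = ∑ b, ∑ a, ∑ a', g a * starRingEnd ℂ (g a') *
          (e b a * starRingEnd ℂ (e b a')) := by
          refine sum_congr rfl fun b _ => ?_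
          rw [map_sum, sum_mul_sum]
          refine sum_congr rfl fun a _ => sum_congr rfl fun a' _ => ?_
          rw [map_mul]; ring
      _ = ∑ a, ∑ a', g a * starRingEnd ℂ (g a') *
          ∑ b, e b a * starRingEnd ℂ (e b a') := by
          rw [sum_comm]
          refine sum_congr rfl fun a _ => ?_
          rw [sum_comm]
          simp_rw [mul_sum]
      _ = _ := by
          simp_rw [he]
          simp [mul_sum, mul_comm]
  simp_rw [Complex.mul_conj, Complex.normSq_eq_norm_sq] at h
  exact_mod_cast h

lemma ringChar_ne_two_of_card_mod_four {F : Type*} [Field F] [Fintype F]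
    (hq : Fintype.card F % 4 = 3) : ringChar F ≠ 2 := by
  intro h
  have := FiniteField.even_card_of_char_two h
  omega

lemma four_ne_zero_of_card_mod_four {F : Type*} [Field F] [Fintype F]
    (hq : Fintype.card F % 4 = 3) : (4 : F) ≠ 0 := by
  have h2 : (2 : F) ≠ 0 := Ring.two_ne_zero (ringChar_ne_two_of_card_mod_four hq)
  rw [show (4 : F) = 2 * 2 by norm_num]
  exact mul_ne_zero h2 h2

lemma sum_neg_inv_four_mul {F M : Type*} [Field F] [Fintype F]
    [AddCommMonoid M] (h4 : (4 : F) ≠ 0) (h : F → M) :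
    ∑ u, h (-(4 * u)⁻¹) = ∑ u, h u := by
  have hinv : Function.Involutive fun u : F => -(4 * u)⁻¹ := fun u => by
    rcases eq_or_ne u 0 with rfl | hu
    · simp
    · field_simp
  exact Equiv.sum_comp hinv.toPerm h

section Characters

variable {F : Type*} [Field F] [Fintype F] [DecidableEq F] {χ : AddChar F ℂ}

lemma sum_addChar_mul (hχ : χ ≠ 1) (a : F) :
    ∑ u, χ (u * a) = if a = 0 then (Fintype.card F : ℂ) else 0 := by
  rw [AddChar.sum_mulShift a (AddChar.IsPrimitive.of_ne_one hχ)]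
  split_ifs <;> simp

lemma sum_addChar_dotP (hχ : χ ≠ 1) {n : ℕ} (z : Fin n → F) :
    ∑ m, χ (dotP m z) = if z = 0 then (Fintype.card F : ℂ) ^ n else 0 := by
  have h := prod_univ_sum (fun _ : Fin n => (univ : Finset F)) (fun i a => χ (a * z i))
  rw [Fintype.piFinset_univ] at h
  simp_rw [dotP, AddChar.map_finset_sum_eq_prod]
  rw [← h]
  simp_rw [sum_addChar_mul hχ]
  split_ifs with hz
  · simp [hz]
  · obtain ⟨i, hi⟩ := Function.ne_iff.mp hz
    exact prod_eq_zero (mem_univ i) (if_neg hi)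

lemma sum_norm_sq_addChar_mul (hχ : χ ≠ 1) (g : F → ℂ) :
    ∑ u, ‖∑ t, g t * χ (u * t)‖ ^ 2 = Fintype.card F * ∑ t, ‖g t‖ ^ 2 := by
  refine sum_norm_sq_eq_of_orthogonal (fun u t => χ (u * t)) _ (fun a b => ?_) g
  simp_rw [← AddChar.map_neg_eq_conj, ← AddChar.map_add_eq_mul, ← sub_eq_add_neg, ← mul_sub]
  rw [sum_addChar_mul hχ]
  simp [sub_eq_zero]

lemma sum_norm_sq_addChar_dotP (hχ : χ ≠ 1) {n : ℕ} (X : Finset (Fin n → F)) :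
    ∑ m, ‖∑ x ∈ X, χ (-dotP m x)‖ ^ 2 = (Fintype.card F : ℝ) ^ n * X.card := by
  have h := sum_norm_sq_eq_of_orthogonal (fun m x : Fin n → F => χ (-dotP m x))
    ((Fintype.card F : ℝ) ^ n) (fun a b => ?_) (fun x => if x ∈ X then 1 else 0)
  · simpa [← sum_filter, ite_pow, apply_ite] using h
  · simp_rw [← AddChar.map_neg_eq_conj, ← AddChar.map_add_eq_mul]
    have : ∀ m, -dotP m a + - -dotP m b = dotP m (b - a) := fun m => by
      rw [dotP_sub_right]; ring
    simp_rw [this]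
    rw [sum_addChar_dotP hχ]
    simp [sub_eq_zero, eq_comm]

/-- The quadratic Gauss sum squares to `-q` when `q ≡ 3 (mod 4)`. -/
lemma sq_sum_addChar_mul_self (hχ : χ ≠ 1) (hq : Fintype.card F % 4 = 3) {u : F} (hu : u ≠ 0) :
    (∑ x, χ (u * (x * x))) ^ 2 = -(Fintype.card F : ℂ) := by
  have h2 := ringChar_ne_two_of_card_mod_four hq
  set η : MulChar F ℂ := (quadraticChar F).ringHomComp (Int.castRingHom ℂ) with hη
  have hprim : (χ.mulShift u).IsPrimitive :=
    AddChar.IsPrimitive.of_ne_one (AddChar.IsPrimitive.of_ne_one hχ hu)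
  have hsum : ∑ x, χ (u * (x * x)) = gaussSum η (χ.mulShift u) := by
    have h0 : ∑ a, χ.mulShift u a = 0 := by
      have := sum_addChar_mul hχ u
      rw [if_neg hu] at this
      simpa [AddChar.mulShift_apply, mul_comm] using this
    calc ∑ x, χ (u * (x * x))
        = ∑ a : F, ∑ x with x ^ 2 = a, χ.mulShift u a := by
          rw [← sum_fiberwise univ (fun x : F => x ^ 2)]
          refine sum_congr rfl fun a _ => sum_congr rfl fun x hx => ?_
          rw [← (mem_filter.mp hx).2, AddChar.mulShift_apply, sq]
      _ = ∑ a : F, (η a + 1) * χ.mulShift u a := by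
          refine sum_congr rfl fun a _ => ?_
          have hc := quadraticChar_card_sqrts h2 a
          rw [sum_const, nsmul_eq_mul]
          congr 1
          have : (((univ.filter fun x : F => x ^ 2 = a).card : ℤ) : ℂ)
              = ((quadraticChar F a + 1 : ℤ) : ℂ) := by
            rw [← hc]; congr 3; ext; simp
          simpa [hη] using this
      _ = _ := by simp_rw [add_mul, sum_add_distrib, one_mul, h0, add_zero, gaussSum]
  have hη1 : η ≠ 1 := by
    rw [hη, Ne, MulChar.ringHomComp_eq_one_iff (RingHom.injective_int (Int.castRingHom ℂ))]
    exact quadraticChar_ne_one h2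
  rw [hsum, gaussSum_sq hη1 ((quadraticChar_isQuadratic F).comp _) hprim, hη]
  have h4 : (Fintype.card F : ZMod 4) = 3 := by
    rw [← ZMod.natCast_mod, hq]; rfl
  simp [quadraticChar_neg_one h2, h4]

/-- The Fourier transform of the Gaussian `m ↦ χ(u‖m‖)` in dimension `2k` with `k` odd,
for `q ≡ 3 (mod 4)`. -/
lemma sum_addChar_nrm_add_dotP (hχ : χ ≠ 1) (hq : Fintype.card F % 4 = 3) {k : ℕ} (hk : Odd k)
    {u : F} (hu : u ≠ 0) (z : Fin (2 * k) → F) :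
    ∑ m, χ (u * nrm m + dotP m z) = -(Fintype.card F : ℂ) ^ k * χ (-(4 * u)⁻¹ * nrm z) := by
  have h2 : (2 : F) ≠ 0 := Ring.two_ne_zero (ringChar_ne_two_of_card_mod_four hq)
  have h4 := four_ne_zero_of_card_mod_four hq
  have h1 : ∀ a : F, ∑ x, χ (u * (x * x) + x * a)
      = χ (-(4 * u)⁻¹ * (a * a)) * ∑ x, χ (u * (x * x)) := fun a => by
    rw [mul_sum, ← Equiv.sum_comp (Equiv.subRight ((2 * u)⁻¹ * a))]
    refine sum_congr rfl fun x _ => ?_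
    rw [← AddChar.map_add_eq_mul, Equiv.subRight_apply]
    congr 1
    field_simp
    ring
  have h := prod_univ_sum (fun _ : Fin (2 * k) => (univ : Finset F))
    (fun i a => χ (u * (a * a) + a * z i))
  rw [Fintype.piFinset_univ] at h
  have h3 : ∀ m : Fin (2 * k) → F, u * nrm m + dotP m z
      = ∑ i, (u * (m i * m i) + m i * z i) := fun m => by
    simp [nrm, dotP, sum_add_distrib, mul_sum]
  simp_rw [h3, AddChar.map_finset_sum_eq_prod]
  rw [← h]
  simp_rw [h1]
  rw [prod_mul_distrib, ← AddChar.map_finset_sum_eq_prod, ← mul_sum, prod_const, card_univ,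
    Fintype.card_fin, pow_mul, sq_sum_addChar_mul_self hχ hq hu, hk.neg_pow, mul_comm]
  rfl

/-- A character sum over the zero sphere in dimension `2k` with `k` odd, for `q ≡ 3 (mod 4)`. -/
lemma sum_sph_zero_addChar_dotP (hχ : χ ≠ 1) (hq : Fintype.card F % 4 = 3) {k : ℕ} (hk : Odd k)
    (z : Fin (2 * k) → F) :
    (Fintype.card F : ℂ) * ∑ m ∈ sph F (2 * k) 0, χ (dotP m z)
      = (if z = 0 then (Fintype.card F : ℂ) ^ (2 * k) else 0)
        - (Fintype.card F : ℂ) ^ k * ((if nrm z = 0 then (Fintype.card F : ℂ) else 0) - 1) := by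
  have h1 : (Fintype.card F : ℂ) * ∑ m ∈ sph F (2 * k) 0, χ (dotP m z)
      = ∑ u, ∑ m, χ (u * nrm m + dotP m z) := by
    rw [sum_comm, mul_sum, sph, sum_filter]
    simp_rw [AddChar.map_add_eq_mul, ← sum_mul, sum_addChar_mul hχ]
    refine sum_congr rfl fun m _ => ?_
    split_ifs <;> simp
  have h2 : ∑ u ∈ univ.erase 0, χ (-(4 * u)⁻¹ * nrm z)
      = (if nrm z = 0 then (Fintype.card F : ℂ) else 0) - 1 := by
    rw [← sum_addChar_mul hχ, ← sum_neg_inv_four_mul (four_ne_zero_of_card_mod_four hq),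
      ← add_sum_erase _ _ (mem_univ (0 : F))]
    simp
  rw [h1, ← add_sum_erase _ _ (mem_univ (0 : F)), ← h2,
    sum_congr rfl fun u hu => sum_addChar_nrm_add_dotP hχ hq hk (ne_of_mem_erase hu) z, ← mul_sum]
  simp only [zero_mul, zero_add, sum_addChar_dotP hχ]
  ring

lemma card_sph_mul_le (hχ : χ ≠ 1) (hq : Fintype.card F % 4 = 3) {k : ℕ} (hk : Odd k) (t : F) :
    (Fintype.card F : ℝ) * (sph F (2 * k) t).card ≤ 2 * (Fintype.card F : ℝ) ^ (2 * k) := by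
  have h1 : (Fintype.card F : ℂ) * (sph F (2 * k) t).card
      = ∑ u, χ (-(u * t)) * ∑ m : Fin (2 * k) → F, χ (u * nrm m + dotP m 0) := by
    simp_rw [mul_sum]
    rw [sum_comm, sph, card_filter]
    push_cast
    rw [mul_sum]
    refine sum_congr rfl fun m _ => ?_
    have : ∀ u, χ (-(u * t)) * χ (u * nrm m + dotP m 0) = χ (u * (nrm m - t)) := fun u => by
      rw [← AddChar.map_add_eq_mul]; congr 1; simp [dotP]; ring
    simp_rw [this, sum_addChar_mul hχ, sub_eq_zero]
    split_ifs <;> simp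
  have hk1 := hk.pos
  have hq1 : (1 : ℝ) ≤ Fintype.card F := by exact_mod_cast Fintype.card_pos
  calc (Fintype.card F : ℝ) * (sph F (2 * k) t).card
      = ‖(Fintype.card F : ℂ) * (sph F (2 * k) t).card‖ := by simp
    _ ≤ ∑ u, ‖χ (-(u * t)) * ∑ m : Fin (2 * k) → F, χ (u * nrm m + dotP m 0)‖ := by
        rw [h1]; exact norm_sum_le _ _
    _ = (Fintype.card F : ℝ) ^ (2 * k)
        + ∑ u ∈ univ.erase (0 : F), (Fintype.card F : ℝ) ^ k := by
        rw [← add_sum_erase _ _ (mem_univ (0 : F))]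
        congr 1
        · simp [dotP]
        · refine sum_congr rfl fun u hu => ?_
          rw [sum_addChar_nrm_add_dotP hχ hq hk (ne_of_mem_erase hu)]
          simp
    _ ≤ (Fintype.card F : ℝ) ^ (2 * k) + (Fintype.card F : ℝ) ^ (k + 1) := by
        rw [sum_const, nsmul_eq_mul, pow_succ']
        gcongr
        exact card_le_univ _
    _ ≤ _ := by
        have : (Fintype.card F : ℝ) ^ (k + 1) ≤ (Fintype.card F : ℝ) ^ (2 * k) :=
          pow_le_pow_right₀ hq1 (by omega)
        linarith

/-- The restriction to the sphere of radius `t` of the Fourier transform of the indicator function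
of `X`, transformed back. -/
noncomputable def sphPart (χ : AddChar F ℂ) {n : ℕ} (X : Finset (Fin n → F)) (t : F)
    (y : Fin n → F) : ℂ :=
  ∑ m ∈ sph F n t, χ (dotP y m) * ∑ x ∈ X, χ (-dotP m x)

lemma sphPart_eq {n : ℕ} (X : Finset (Fin n → F)) (t : F) (y : Fin n → F) :
    sphPart χ X t y = ∑ x ∈ X, ∑ m ∈ sph F n t, χ (dotP m (y - x)) := by
  rw [sum_comm]
  simp_rw [sphPart, mul_sum, addChar_dotP_mul]

lemma sum_sphPart {n : ℕ} (X : Finset (Fin n → F)) (t : F) :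
    ∑ y ∈ X, sphPart χ X t y = ((∑ m ∈ sph F n t, ‖∑ x ∈ X, χ (-dotP m x)‖ ^ 2 : ℝ) : ℂ) := by
  simp_rw [sphPart]
  rw [sum_comm]
  push_cast
  refine sum_congr rfl fun m _ => ?_
  rw [← sum_mul, ← Complex.ofReal_pow, ← Complex.normSq_eq_norm_sq, ← Complex.mul_conj, map_sum,
    mul_comm]
  congr 1
  refine sum_congr rfl fun y _ => ?_
  rw [← AddChar.map_neg_eq_conj, neg_neg]
  simp [dotP, mul_comm]

lemma sum_sphPart_mul_addChar {n : ℕ} (X : Finset (Fin n → F)) (u : F) (y : Fin n → F) :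
    ∑ t, sphPart χ X t y * χ (u * t) = ∑ x ∈ X, ∑ m, χ (u * nrm m + dotP m (y - x)) := by
  rw [sum_comm, ← sum_fiberwise univ (nrm : (Fin n → F) → F)]
  refine sum_congr rfl fun t _ => ?_
  rw [sphPart, sum_mul]
  refine sum_congr rfl fun m hm => ?_
  have hm : nrm m = t := (mem_filter.mp hm).2
  rw [mul_sum, sum_mul]
  refine sum_congr rfl fun x _ => ?_
  rw [addChar_dotP_mul, AddChar.map_add_eq_mul, hm, mul_comm]

/-- The number of points of `X` on the sphere of radius `r` with centre `y`. -/
def sphCount {n : ℕ} (X : Finset (Fin n → F)) (r : F) (y : Fin n → F) : ℕ :=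
  (X.filter fun x => nrm (x - y) = r).card

lemma sum_sphCount_mul_addChar {n : ℕ} (X : Finset (Fin n → F)) (s : F) (y : Fin n → F) :
    ∑ r, (sphCount X r y : ℂ) * χ (s * r) = ∑ x ∈ X, χ (s * nrm (y - x)) := by
  rw [← sum_fiberwise X (fun x => nrm (x - y))]
  refine sum_congr rfl fun r _ => ?_
  rw [sphCount, ← nsmul_eq_mul, ← sum_const]
  refine sum_congr rfl fun x hx => ?_
  rw [← (mem_filter.mp hx).2, ← nrm_neg, neg_sub]

lemma sum_sphCount {n : ℕ} (X : Finset (Fin n → F)) (y : Fin n → F) :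
    ∑ r, (sphCount X r y : ℂ) = X.card := by
  simpa using sum_sphCount_mul_addChar (χ := (1 : AddChar F ℂ)) X 0 y

lemma card_isosceles {n : ℕ} (X : Finset (Fin n → F)) :
    ((X ×ˢ X ×ˢ X).filter fun t => nrm (t.1 - t.2.1) = nrm (t.2.2 - t.2.1)).card
      = ∑ y ∈ X, ∑ r, sphCount X r y ^ 2 := by
  rw [card_filter, sum_product]
  simp_rw [sum_product]
  rw [sum_comm]
  refine sum_congr rfl fun y _ => ?_
  simp_rw [sq, sphCount, card_filter, sum_mul_sum]
  symm
  rw [sum_comm]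
  refine sum_congr rfl fun x _ => ?_
  rw [sum_comm]
  refine sum_congr rfl fun z _ => ?_
  simp [eq_comm]

/-- Sums of squares of the sphere counts are controlled by those of the pieces of the Fourier
transform on spheres. -/
lemma sum_sphCount_sq_le (hχ : χ ≠ 1) (hq : Fintype.card F % 4 = 3) {k : ℕ} (hk : Odd k)
    (X : Finset (Fin (2 * k) → F)) (y : Fin (2 * k) → F) :
    (Fintype.card F : ℝ) ^ (2 * k) * (Fintype.card F * ∑ r, (sphCount X r y : ℝ) ^ 2)
      ≤ (Fintype.card F : ℝ) ^ (2 * k) * (X.card : ℝ) ^ 2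
        + Fintype.card F * ∑ t, ‖sphPart χ X t y‖ ^ 2 := by
  have h4 := four_ne_zero_of_card_mod_four hq
  have h1 := sum_norm_sq_addChar_mul hχ fun r => (sphCount X r y : ℂ)
  simp only [Complex.norm_natCast] at h1
  rw [← h1, ← sum_norm_sq_addChar_mul hχ, ← sum_neg_inv_four_mul h4,
    ← add_sum_erase _ _ (mem_univ (0 : F)), mul_add]
  refine add_le_add ?_ ?_
  · simp [sum_sphCount]
  · rw [mul_sum]
    refine le_trans (sum_le_sum fun u hu => le_of_eq ?_)
      (sum_le_univ_sum_of_nonneg (s := univ.erase 0) fun u => sq_nonneg _)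
    rw [sum_sphPart_mul_addChar, sum_sphCount_mul_addChar]
    simp_rw [sum_addChar_nrm_add_dotP hχ hq hk (ne_of_mem_erase hu)]
    rw [← mul_sum, norm_mul, mul_pow]
    simp [mul_comm 2 k, pow_mul]

lemma card_mul_sphPart_zero (hχ : χ ≠ 1) (hq : Fintype.card F % 4 = 3) {k : ℕ} (hk : Odd k)
    (X : Finset (Fin (2 * k) → F)) {y : Fin (2 * k) → F} (hy : y ∈ X) :
    (Fintype.card F : ℂ) * sphPart χ X 0 y = (Fintype.card F : ℂ) ^ (2 * k)
      - (Fintype.card F : ℂ) ^ k * (Fintype.card F * sphCount X 0 y - X.card) := by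
  have h : ∑ x ∈ X, (if nrm (y - x) = 0 then (Fintype.card F : ℂ) else 0)
      = Fintype.card F * sphCount X 0 y := by
    rw [← sum_filter, sum_const, nsmul_eq_mul, sphCount, mul_comm]
    congr 4
    ext x
    rw [← nrm_neg, neg_sub]
  rw [sphPart_eq, mul_sum]
  simp_rw [sum_sph_zero_addChar_dotP hχ hq hk]
  rw [sum_sub_distrib, ← mul_sum, sum_sub_distrib, h]
  simp [sub_eq_zero, hy]

lemma sum_sphCount_zero_le (hχ : χ ≠ 1) (hq : Fintype.card F % 4 = 3) {k : ℕ} (hk : Odd k)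
    (X : Finset (Fin (2 * k) → F)) :
    (Fintype.card F : ℝ) * ∑ y ∈ X, (sphCount X 0 y : ℝ)
      ≤ (X.card : ℝ) ^ 2 + (Fintype.card F : ℝ) ^ k * X.card := by
  have h := sum_congr rfl fun y hy => card_mul_sphPart_zero hχ hq hk X hy
  rw [← mul_sum, sum_sphPart, sum_sub_distrib, ← mul_sum, sum_sub_distrib, ← mul_sum, sum_const,
    sum_const, nsmul_eq_mul, nsmul_eq_mul] at h
  have hR : (Fintype.card F : ℝ) * ∑ m ∈ sph F (2 * k) 0, ‖∑ x ∈ X, χ (-dotP m x)‖ ^ 2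
      = X.card * (Fintype.card F : ℝ) ^ (2 * k) - (Fintype.card F : ℝ) ^ k *
        (Fintype.card F * ∑ y ∈ X, (sphCount X 0 y : ℝ) - X.card * X.card) := by
    exact_mod_cast h
  have hpos : 0 ≤ (Fintype.card F : ℝ) *
      ∑ m ∈ sph F (2 * k) 0, ‖∑ x ∈ X, χ (-dotP m x)‖ ^ 2 := by positivity
  have hq0 : (0 : ℝ) < Fintype.card F := by exact_mod_cast Fintype.card_pos
  refine le_of_mul_le_mul_left ?_ (pow_pos hq0 k)
  rw [hR] at hpos
  ring_nf at hpos ⊢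
  linarith

lemma sum_norm_sq_sphPart_zero_le (hχ : χ ≠ 1) (hq : Fintype.card F % 4 = 3) {k : ℕ} (hk : Odd k)
    (X : Finset (Fin (2 * k) → F)) :
    (Fintype.card F : ℝ) ^ 2 * ∑ y ∈ X, ‖sphPart χ X 0 y‖ ^ 2
      ≤ 3 * (Fintype.card F : ℝ) ^ (2 * k) * ((Fintype.card F : ℝ) ^ (2 * k) * X.card
        + Fintype.card F * (X.card : ℝ) ^ 3
        + (Fintype.card F : ℝ) ^ (k + 1) * (X.card : ℝ) ^ 2 + (X.card : ℝ) ^ 3) := by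
  set q : ℝ := (Fintype.card F : ℝ) with hq'
  have hq0 : 0 ≤ q := Nat.cast_nonneg _
  have hx0 : (0 : ℝ) ≤ X.card := Nat.cast_nonneg _
  have h1 : ∀ y ∈ X, q ^ 2 * ‖sphPart χ X 0 y‖ ^ 2 ≤ 3 * q ^ (2 * k) *
      (q ^ (2 * k) + q ^ 2 * X.card * sphCount X 0 y + (X.card : ℝ) ^ 2) := fun y hy => by
    have hN : (sphCount X 0 y : ℝ) ≤ X.card := by exact_mod_cast card_filter_le _ _
    have h : q * ‖sphPart χ X 0 y‖
        = |q ^ (2 * k) - q ^ k * (q * sphCount X 0 y - X.card)| := by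
      rw [← Real.norm_eq_abs, ← Complex.norm_real, hq', ← Complex.norm_natCast (Fintype.card F),
        ← norm_mul, card_mul_sphPart_zero hχ hq hk X hy]
      simp
    have hpow : q ^ (2 * k) = (q ^ k) ^ 2 := by rw [mul_comm, pow_mul]
    rw [← mul_pow, h, sq_abs, hpow]
    have hNN : (sphCount X 0 y : ℝ) ^ 2 ≤ X.card * sphCount X 0 y := by
      rw [sq]; gcongr
    have := mul_le_mul_of_nonneg_left hNN (show 0 ≤ (q ^ k) ^ 2 * q ^ 2 by positivity)
    nlinarith [sq_nonneg ((q ^ k) ^ 2 + q ^ k * (q * sphCount X 0 y)),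
      sq_nonneg ((q ^ k) ^ 2 - q ^ k * X.card),
      sq_nonneg (q ^ k * (q * sphCount X 0 y) + q ^ k * X.card)]
  have h2 := sum_le_sum h1
  rw [← mul_sum, ← mul_sum, sum_add_distrib, sum_add_distrib, ← mul_sum, sum_const, sum_const,
    nsmul_eq_mul, nsmul_eq_mul] at h2
  refine h2.trans (mul_le_mul_of_nonneg_left ?_ (by positivity))
  have h3 := mul_le_mul_of_nonneg_left (sum_sphCount_zero_le hχ hq hk X)
    (mul_nonneg hq0 hx0)
  rw [← hq'] at h3
  ring_nf at h3 ⊢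
  linarith

/-- An `L² → L^p` extension estimate for the counting measure on `S`, with `p = (2n+4)/n`, implies
an `L²` bound on every finite set `X` by Hölder's inequality. -/
lemma sum_norm_sq_le_of_extension {α β : Type*} [Fintype β] {n : ℕ} (hn : 0 < n) {C₁ : ℝ}
    (S : Finset α) (f : α → ℂ) (e : β → α → ℂ)
    (H : (∑ w, ‖((S.card : ℂ))⁻¹ * ∑ x ∈ S, e w x * f x‖ ^ ((2 * (n : ℝ) + 4) / (n : ℝ)))
        ^ ((n : ℝ) / (2 * (n : ℝ) + 4))
      ≤ C₁ * (((S.card : ℝ))⁻¹ * ∑ x ∈ S, ‖f x‖ ^ 2) ^ ((1 : ℝ) / 2))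
    (X : Finset β) :
    ∑ y ∈ X, ‖∑ x ∈ S, e y x * f x‖ ^ 2
      ≤ C₁ ^ 2 * (X.card : ℝ) ^ (2 / ((n : ℝ) + 2)) * (S.card * ∑ x ∈ S, ‖f x‖ ^ 2) := by
  rcases S.eq_empty_or_nonempty with rfl | hS
  · simp
  have hn' : (0 : ℝ) < n := by exact_mod_cast hn
  have hS' : (0 : ℝ) < S.card := by exact_mod_cast hS.card_pos
  set g : β → ℝ := fun w => ‖((S.card : ℂ))⁻¹ * ∑ x ∈ S, e w x * f x‖ with hg
  set B := ∑ x ∈ S, ‖f x‖ ^ 2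
  have hB0 : 0 ≤ B := sum_nonneg fun x _ => sq_nonneg _
  set W := ∑ w, g w ^ ((2 * (n : ℝ) + 4) / (n : ℝ))
  have hg0 : ∀ w, 0 ≤ g w := fun w => norm_nonneg _
  have hW0 : 0 ≤ W := sum_nonneg fun w _ => Real.rpow_nonneg (hg0 w) _
  have h1 : W ^ ((n : ℝ) / (n + 2)) ≤ C₁ ^ 2 * ((S.card : ℝ)⁻¹ * B) := by
    have h := pow_le_pow_left₀ (Real.rpow_nonneg hW0 _) H 2
    rw [← Real.rpow_mul_natCast hW0, mul_pow, ← Real.rpow_mul_natCast (by positivity)] at h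
    rw [show (1 : ℝ) / 2 * (2 : ℕ) = 1 by norm_num, Real.rpow_one,
      show (n : ℝ) / (2 * n + 4) * (2 : ℕ) = n / (n + 2) by push_cast; field_simp; ring] at h
    exact h
  have h2 : ∑ y ∈ X, g y ^ 2 ≤ (X.card : ℝ) ^ (2 / ((n : ℝ) + 2)) * W ^ ((n : ℝ) / (n + 2)) := by
    have h := Real.rpow_sum_le_const_mul_sum_rpow_of_nonneg X (f := fun y => g y ^ 2)
      (p := ((n : ℝ) + 2) / n) (by rw [le_div_iff₀ hn']; linarith) fun y _ => sq_nonneg _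
    have h3 : ∑ y ∈ X, (g y ^ 2) ^ (((n : ℝ) + 2) / n) ≤ W := by
      refine le_trans (le_of_eq (sum_congr rfl fun y _ => ?_))
        (sum_le_univ_sum_of_nonneg fun w => Real.rpow_nonneg (hg0 w) _)
      rw [← Real.rpow_natCast_mul (hg0 y)]
      congr 1
      push_cast
      ring
    have h4 := Real.rpow_le_rpow (Real.rpow_nonneg (sum_nonneg fun y _ => sq_nonneg _) _)
      (h.trans (mul_le_mul_of_nonneg_left h3 (by positivity)))
      (show (0 : ℝ) ≤ (n : ℝ) / (n + 2) by positivity)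
    rw [← Real.rpow_mul (sum_nonneg fun y _ => sq_nonneg _), Real.mul_rpow (by positivity) hW0,
      ← Real.rpow_mul (by positivity)] at h4
    convert h4 using 2
    · rw [show ((n : ℝ) + 2) / n * (n / (n + 2)) = 1 by field_simp, Real.rpow_one]
    · congr 1; field_simp; ring
  have h5 : ∀ y, ‖∑ x ∈ S, e y x * f x‖ ^ 2 = (S.card : ℝ) ^ 2 * g y ^ 2 := fun y => by
    simp only [hg, norm_mul, norm_inv, Complex.norm_natCast]
    field_simp
  simp_rw [h5]
  rw [← mul_sum]
  calc _ ≤ (S.card : ℝ) ^ 2 * ((X.card : ℝ) ^ (2 / ((n : ℝ) + 2))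
        * (C₁ ^ 2 * ((S.card : ℝ)⁻¹ * B))) := by gcongr; exact h2.trans (by gcongr)
    _ = _ := by field_simp

/-- The contribution of the spheres of nonzero radius, given the bound of the extension estimate. -/
lemma sum_norm_sq_sphPart_erase_zero_le (hχ : χ ≠ 1) (hq : Fintype.card F % 4 = 3) {k : ℕ}
    (hk : Odd k) (X : Finset (Fin (2 * k) → F)) {M : ℝ} (hM : 0 ≤ M)
    (H : ∀ t ≠ 0, ∑ y ∈ X, ‖sphPart χ X t y‖ ^ 2 ≤ M * ((sph F (2 * k) t).card *
      ∑ m ∈ sph F (2 * k) t, ‖∑ x ∈ X, χ (-dotP m x)‖ ^ 2)) :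
    (Fintype.card F : ℝ) * ∑ t ∈ univ.erase 0, ∑ y ∈ X, ‖sphPart χ X t y‖ ^ 2
      ≤ 2 * M * (Fintype.card F : ℝ) ^ (4 * k) * X.card := by
  have h : ∑ t, ∑ m ∈ sph F (2 * k) t, ‖∑ x ∈ X, χ (-dotP m x)‖ ^ 2
      = (Fintype.card F : ℝ) ^ (2 * k) * X.card := by
    rw [← sum_norm_sq_addChar_dotP hχ]
    exact sum_fiberwise univ nrm _
  calc _ ≤ ∑ t ∈ univ.erase (0 : F), 2 * M * (Fintype.card F : ℝ) ^ (2 * k) *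
        ∑ m ∈ sph F (2 * k) t, ‖∑ x ∈ X, χ (-dotP m x)‖ ^ 2 := by
        rw [mul_sum]
        refine sum_le_sum fun t ht => ?_
        calc _ ≤ (Fintype.card F : ℝ) * (M * ((sph F (2 * k) t).card *
              ∑ m ∈ sph F (2 * k) t, ‖∑ x ∈ X, χ (-dotP m x)‖ ^ 2)) := by
              gcongr; exact H t (ne_of_mem_erase ht)
          _ = M * ((Fintype.card F : ℝ) * (sph F (2 * k) t).card) *
              ∑ m ∈ sph F (2 * k) t, ‖∑ x ∈ X, χ (-dotP m x)‖ ^ 2 := by ring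
          _ ≤ M * (2 * (Fintype.card F : ℝ) ^ (2 * k)) *
              ∑ m ∈ sph F (2 * k) t, ‖∑ x ∈ X, χ (-dotP m x)‖ ^ 2 := by
              gcongr M * ?_ * _; exact card_sph_mul_le hχ hq hk t
          _ = _ := by ring
    _ ≤ 2 * M * (Fintype.card F : ℝ) ^ (2 * k) *
        ∑ t, ∑ m ∈ sph F (2 * k) t, ‖∑ x ∈ X, χ (-dotP m x)‖ ^ 2 := by
        rw [← mul_sum]
        gcongr
        exact erase_subset _ _
    _ = _ := by rw [h]; ring

end Characters

/-- Theorem on isosceles triangles: for `n ≡ 2 (mod 4)`, `q ≡ 3 (mod 4)`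
and `X ⊆ 𝔽_q^n`, assuming the `L² → L^{(2n+4)/n}` extension estimate (with constant `C₁`)
for all spheres of nonzero radius in `𝔽_q^n`, the number of isosceles triangles
`#{(x,y,z) ∈ X³ : ‖x-y‖ = ‖z-y‖}` is at most
`C (|X|³/q + q^{n-1} |X|^{(n+4)/(n+2)} + q^{(n-2)/2} |X|²)`. -/
theorem stmt8 (C₁ : ℝ) (hC₁ : 0 < C₁) :
    ∃ C : ℝ, 0 < C ∧
      ∀ (n : ℕ) (hn : n % 4 = 2)
        (F : Type) [Field F] [Fintype F] [DecidableEq F]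
        (hq : Fintype.card F % 4 = 3)
        (χ : AddChar F ℂ) (hχ : χ ≠ 1)
        (X : Finset (Fin n → F)),
        -- the extension estimate hypothesis for every sphere of nonzero radius in 𝔽_q^n
        (∀ r : F, r ≠ 0 → ∀ f : (Fin n → F) → ℂ,
          (∑ w : Fin n → F,
              ‖(((sph F n r).card : ℂ))⁻¹ * ∑ x ∈ sph F n r, χ (dotP w x) * f x‖ ^
                ((2 * (n : ℝ) + 4) / (n : ℝ))) ^ ((n : ℝ) / (2 * (n : ℝ) + 4)) ≤
            C₁ * ((((sph F n r).card : ℝ))⁻¹ * ∑ x ∈ sph F n r, ‖f x‖ ^ 2) ^ ((1 : ℝ) / 2)) →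
        ((((X ×ˢ X ×ˢ X).filter fun t =>
            nrm (t.1 - t.2.1) = nrm (t.2.2 - t.2.1)).card : ℝ)) ≤
          C * ((X.card : ℝ) ^ 3 / (Fintype.card F : ℝ)
            + (Fintype.card F : ℝ) ^ ((n : ℝ) - 1) *
                (X.card : ℝ) ^ (((n : ℝ) + 4) / ((n : ℝ) + 2))
            + (Fintype.card F : ℝ) ^ (((n : ℝ) - 2) / 2) * (X.card : ℝ) ^ 2) := by
  refine ⟨7 + 2 * C₁ ^ 2, by positivity, ?_⟩
  intro n hn F _ _ _ hq χ hχ X H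
  obtain ⟨k, rfl⟩ : ∃ k, n = 2 * k := ⟨n / 2, by omega⟩
  have hk : Odd k := by rw [Nat.odd_iff]; omega
  rw [card_isosceles]
  set x : ℝ := (X.card : ℝ) with hx
  set q : ℝ := (Fintype.card F : ℝ) with hq'
  have hq1 : 1 ≤ q := by rw [hq']; exact_mod_cast Fintype.card_pos
  have hq0 : 0 < q := by linarith
  have hx0 : 0 ≤ x := by positivity
  have hA := sum_norm_sq_sphPart_erase_zero_le hχ hq hk X
    (M := C₁ ^ 2 * x ^ (2 / (((2 * k : ℕ) : ℝ) + 2))) (by positivity) fun t ht =>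
      sum_norm_sq_le_of_extension (by omega) _ _ _ (H t ht _) X
  have hB := sum_norm_sq_sphPart_zero_le hχ hq hk X
  have hN := sum_le_sum fun y (_ : y ∈ X) => sum_sphCount_sq_le hχ hq hk X y
  rw [← mul_sum, ← mul_sum, sum_add_distrib, sum_const, nsmul_eq_mul, ← mul_sum,
    sum_comm (f := fun y t => ‖sphPart χ X t y‖ ^ 2),
    ← add_sum_erase _ (fun t => ∑ y ∈ X, ‖sphPart χ X t y‖ ^ 2) (mem_univ (0 : F))] at hN
  rw [← hx, ← hq'] at hA hB hN
  have hxb : x * x ^ (2 / (((2 * k : ℕ) : ℝ) + 2))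
      = x ^ ((((2 * k : ℕ) : ℝ) + 4) / (((2 * k : ℕ) : ℝ) + 2)) := by
    rw [show (((2 * k : ℕ) : ℝ) + 4) / (((2 * k : ℕ) : ℝ) + 2)
      = 1 + 2 / (((2 * k : ℕ) : ℝ) + 2) by field_simp; ring,
      Real.rpow_add_of_nonneg hx0 zero_le_one (by positivity), Real.rpow_one]
  have hxle : x ≤ x ^ ((((2 * k : ℕ) : ℝ) + 4) / (((2 * k : ℕ) : ℝ) + 2)) := by
    rcases Nat.eq_zero_or_pos X.card with h | h
    · rw [hx, h]; simpa using Real.rpow_nonneg le_rfl _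
    · refine Real.self_le_rpow_of_one_le (by rw [hx]; exact_mod_cast h) ?_
      rw [le_div_iff₀ (by positivity)]
      linarith
  have he1 : q ^ (((2 * k : ℕ) : ℝ) - 1) = q ^ (2 * k) / q := by
    rw [Real.rpow_sub_one hq0.ne', Real.rpow_natCast]
  have he2 : q ^ ((((2 * k : ℕ) : ℝ) - 2) / 2) = q ^ k / q := by
    rw [show (((2 * k : ℕ) : ℝ) - 2) / 2 = (k : ℝ) - 1 by push_cast; ring,
      Real.rpow_sub_one hq0.ne', Real.rpow_natCast]
  rw [he1, he2]
  set z := x ^ ((((2 * k : ℕ) : ℝ) + 4) / (((2 * k : ℕ) : ℝ) + 2))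
  set w := x ^ (2 / (((2 * k : ℕ) : ℝ) + 2))
  have hz0 : 0 ≤ z := Real.rpow_nonneg hx0 _
  push_cast
  set N := ∑ y ∈ X, ∑ r, (sphCount X r y : ℝ) ^ 2
  have hkey : q ^ (2 * k) * (q ^ 2 * N) ≤ q ^ (2 * k) * (q * x ^ 3
      + 3 * (q ^ (2 * k) * x + q * x ^ 3 + q ^ (k + 1) * x ^ 2 + x ^ 3)
      + 2 * C₁ ^ 2 * q ^ (2 * k + 1) * z) := by
    have hqN := mul_le_mul_of_nonneg_left hN hq0.le
    have hqA := mul_le_mul_of_nonneg_left hA hq0.le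
    rw [← hxb]
    ring_nf at hqN hqA hB ⊢
    linarith
  have hkey' := le_of_mul_le_mul_left hkey (by positivity)
  have h1 : x ^ 3 ≤ q * x ^ 3 := le_mul_of_one_le_left (by positivity) hq1
  have h2 : q ^ (2 * k) * x ≤ q ^ (2 * k + 1) * z := by gcongr; omega
  have h3 : 0 ≤ q * x ^ 3 := by positivity
  have h4 : 0 ≤ q ^ (2 * k + 1) * z := by positivity
  have h5 : 0 ≤ q ^ (k + 1) * x ^ 2 := by positivity
  have h6 : q ^ 2 * N ≤ (7 + 2 * C₁ ^ 2) *
      (q * x ^ 3 + q ^ (2 * k + 1) * z + q ^ (k + 1) * x ^ 2) := by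
    nlinarith [mul_nonneg (sq_nonneg C₁) h3, mul_nonneg (sq_nonneg C₁) h5]
  refine le_of_mul_le_mul_left (h6.trans (le_of_eq ?_)) (pow_pos hq0 2)
  field_simp
  ring
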